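/- Let n be a natural number, let η : ℝⁿ → ℝⁿ be an invertible linear map, let r, r′, q ∈ ℝⁿ, let ℏ ∈ ℝ, and let H : ℝⁿ → ℂ be a smooth function with compact support. Then the iterated integral ∫_{ℝⁿ} dX e^{i⟨r′,q⟩} e^{(i/2)⟨r′,X⟩} ∫_{ℝⁿ} dξ e^{−i⟨ξ,X⟩} ∫_{ℝⁿ} dY e^{i⟨r, q + ℏ η(ξ)⟩} e^{(i/2)⟨r,Y⟩} ∫_{ℝⁿ} dζ e^{−i⟨ζ,Y⟩} H(η(ζ + ξ)) is well defined (each successive integrand is Lebesgue integrable) and equals (2π)^{2n} · e^{i⟨r + r′, q⟩} · e^{(iℏ/2)⟨r, η(r′)⟩} · H(η(r + r′)/2). -/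

import Mathlib

open MeasureTheory InnerProductSpace

open scoped FourierTransform

lemma ft_eq (n : ℕ) (G : EuclideanSpace ℝ (Fin n) → ℂ) (Y : EuclideanSpace ℝ (Fin n)) :
    (∫ ζ : EuclideanSpace ℝ (Fin n), Complex.exp (-Complex.I * (⟪ζ, Y⟫_ℝ : ℂ)) * G ζ) =
      𝓕 G ((2 * Real.pi)⁻¹ • Y) := by
  rw [Real.fourier_eq']
  congr 1
  ext ζ
  rw [smul_eq_mul, inner_smul_right]
  congr 2
  have := Real.pi_ne_zero
  have h : -2 * Real.pi * ((2 * Real.pi)⁻¹ * ⟪ζ, Y⟫_ℝ) = - ⟪ζ, Y⟫_ℝ := by field_simp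
  rw [h]
  push_cast
  ring

lemma exp_integrable (n : ℕ) (G : EuclideanSpace ℝ (Fin n) → ℂ) (hG : Continuous G)
    (hs : HasCompactSupport G) (Y : EuclideanSpace ℝ (Fin n)) :
    Integrable (fun ζ : EuclideanSpace ℝ (Fin n) =>
      Complex.exp (-Complex.I * (⟪ζ, Y⟫_ℝ : ℂ)) * G ζ) := by
  apply Continuous.integrable_of_hasCompactSupport
  · fun_prop
  · exact hs.mul_left

lemma key (n : ℕ) (G : EuclideanSpace ℝ (Fin n) → ℂ) (hG : ContDiff ℝ (⊤ : ℕ∞) G)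
    (hs : HasCompactSupport G) (r : EuclideanSpace ℝ (Fin n)) (c : ℂ) :
    Integrable (fun Y : EuclideanSpace ℝ (Fin n) =>
      c * Complex.exp (Complex.I / 2 * (⟪r, Y⟫_ℝ : ℂ)) *
        ∫ ζ : EuclideanSpace ℝ (Fin n), Complex.exp (-Complex.I * (⟪ζ, Y⟫_ℝ : ℂ)) * G ζ) ∧
    (∫ Y : EuclideanSpace ℝ (Fin n),
      c * Complex.exp (Complex.I / 2 * (⟪r, Y⟫_ℝ : ℂ)) *
        ∫ ζ : EuclideanSpace ℝ (Fin n), Complex.exp (-Complex.I * (⟪ζ, Y⟫_ℝ : ℂ)) * G ζ) =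
      c * (((2 * Real.pi) ^ n : ℝ) : ℂ) * G ((2 : ℝ)⁻¹ • r) := by
  have hpi := Real.pi_pos
  have hpi0 := Real.pi_ne_zero
  let S := hs.toSchwartzMap hG
  have hS : (S : EuclideanSpace ℝ (Fin n) → ℂ) = G := rfl
  have hGi : Integrable G := hS ▸ S.integrable
  have hFi : Integrable (𝓕 G) := by
    rw [← hS, ← SchwartzMap.fourier_coe]
    exact (𝓕 S).integrable
  let K : EuclideanSpace ℝ (Fin n) → ℂ := fun y =>
    Complex.exp (((2 * Real.pi * ⟪y, (2 : ℝ)⁻¹ • r⟫_ℝ : ℝ) : ℂ) * Complex.I) • 𝓕 G y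
  have hK : ∫ y, K y = G ((2 : ℝ)⁻¹ • r) := by
    have := congrFun (hG.continuous.fourierInv_fourier_eq hGi hFi) ((2 : ℝ)⁻¹ • r)
    rw [Real.fourierInv_eq'] at this
    exact this
  have hKi : Integrable K := by
    refine hFi.bdd_mul (c := 1) ?_ ?_
    · exact Continuous.aestronglyMeasurable (by fun_prop)
    · exact Filter.Eventually.of_forall fun y => (Complex.norm_exp_ofReal_mul_I _).le
  have hfun : (fun Y : EuclideanSpace ℝ (Fin n) =>
      c * Complex.exp (Complex.I / 2 * (⟪r, Y⟫_ℝ : ℂ)) *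
        ∫ ζ : EuclideanSpace ℝ (Fin n), Complex.exp (-Complex.I * (⟪ζ, Y⟫_ℝ : ℂ)) * G ζ) =
      fun Y => c * K ((2 * Real.pi)⁻¹ • Y) := by
    ext Y
    rw [ft_eq]
    simp only [K]
    rw [smul_eq_mul, mul_assoc]
    congr 3
    rw [inner_smul_left, inner_smul_right, real_inner_comm]
    have h : 2 * Real.pi * ((2 * Real.pi)⁻¹ * (2⁻¹ * ⟪Y, r⟫_ℝ)) = 2⁻¹ * ⟪Y, r⟫_ℝ := by field_simp
    simp only [conj_trivial]
    rw [h]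
    push_cast
    ring
  rw [hfun]
  constructor
  · exact (hKi.comp_smul (inv_ne_zero (by positivity))).const_mul c
  · rw [integral_const_mul, Measure.integral_comp_smul, hK, finrank_euclideanSpace_fin,
      inv_pow, inv_inv, abs_of_nonneg (by positivity), Complex.real_smul, mul_assoc]

/-- Composition of quantised torus characters: the iterated integral
`∫dX e^{i⟨r′,q⟩}e^{(i/2)⟨r′,X⟩} ∫dξ e^{−i⟨ξ,X⟩} ∫dY e^{i⟨r,q+ℏη(ξ)⟩}e^{(i/2)⟨r,Y⟩}
  ∫dζ e^{−i⟨ζ,Y⟩} H(η(ζ+ξ))`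
is well defined and equals
`(2π)^{2n} e^{i⟨r+r′,q⟩} e^{(iℏ/2)⟨r,η(r′)⟩} H(η(r+r′)/2)`. -/
theorem quantisation_torus_product (n : ℕ)
    (η : EuclideanSpace ℝ (Fin n) →ₗ[ℝ] EuclideanSpace ℝ (Fin n))
    (hη : Function.Bijective η)
    (r r' q : EuclideanSpace ℝ (Fin n)) (ℏ : ℝ)
    (H : EuclideanSpace ℝ (Fin n) → ℂ) (hH : ContDiff ℝ (⊤ : ℕ∞) H)
    (hHsupp : HasCompactSupport H) :
    (∀ ξ Y : EuclideanSpace ℝ (Fin n),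
      Integrable (fun ζ : EuclideanSpace ℝ (Fin n) =>
        Complex.exp (-Complex.I * (⟪ζ, Y⟫_ℝ : ℂ)) * H (η (ζ + ξ)))) ∧
    (∀ ξ : EuclideanSpace ℝ (Fin n),
      Integrable (fun Y : EuclideanSpace ℝ (Fin n) =>
        Complex.exp (Complex.I * (⟪r, q + ℏ • η ξ⟫_ℝ : ℂ)) *
          Complex.exp (Complex.I / 2 * (⟪r, Y⟫_ℝ : ℂ)) *
            ∫ ζ : EuclideanSpace ℝ (Fin n),
              Complex.exp (-Complex.I * (⟪ζ, Y⟫_ℝ : ℂ)) * H (η (ζ + ξ)))) ∧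
    (∀ X : EuclideanSpace ℝ (Fin n),
      Integrable (fun ξ : EuclideanSpace ℝ (Fin n) =>
        Complex.exp (-Complex.I * (⟪ξ, X⟫_ℝ : ℂ)) *
          ∫ Y : EuclideanSpace ℝ (Fin n),
            Complex.exp (Complex.I * (⟪r, q + ℏ • η ξ⟫_ℝ : ℂ)) *
              Complex.exp (Complex.I / 2 * (⟪r, Y⟫_ℝ : ℂ)) *
                ∫ ζ : EuclideanSpace ℝ (Fin n),
                  Complex.exp (-Complex.I * (⟪ζ, Y⟫_ℝ : ℂ)) * H (η (ζ + ξ)))) ∧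
    Integrable (fun X : EuclideanSpace ℝ (Fin n) =>
      Complex.exp (Complex.I * (⟪r', q⟫_ℝ : ℂ)) *
        Complex.exp (Complex.I / 2 * (⟪r', X⟫_ℝ : ℂ)) *
          ∫ ξ : EuclideanSpace ℝ (Fin n),
            Complex.exp (-Complex.I * (⟪ξ, X⟫_ℝ : ℂ)) *
              ∫ Y : EuclideanSpace ℝ (Fin n),
                Complex.exp (Complex.I * (⟪r, q + ℏ • η ξ⟫_ℝ : ℂ)) *
                  Complex.exp (Complex.I / 2 * (⟪r, Y⟫_ℝ : ℂ)) *
                    ∫ ζ : EuclideanSpace ℝ (Fin n),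
                      Complex.exp (-Complex.I * (⟪ζ, Y⟫_ℝ : ℂ)) * H (η (ζ + ξ))) ∧
    (∫ X : EuclideanSpace ℝ (Fin n),
      Complex.exp (Complex.I * (⟪r', q⟫_ℝ : ℂ)) *
        Complex.exp (Complex.I / 2 * (⟪r', X⟫_ℝ : ℂ)) *
          ∫ ξ : EuclideanSpace ℝ (Fin n),
            Complex.exp (-Complex.I * (⟪ξ, X⟫_ℝ : ℂ)) *
              ∫ Y : EuclideanSpace ℝ (Fin n),
                Complex.exp (Complex.I * (⟪r, q + ℏ • η ξ⟫_ℝ : ℂ)) *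
                  Complex.exp (Complex.I / 2 * (⟪r, Y⟫_ℝ : ℂ)) *
                    ∫ ζ : EuclideanSpace ℝ (Fin n),
                      Complex.exp (-Complex.I * (⟪ζ, Y⟫_ℝ : ℂ)) * H (η (ζ + ξ))) =
      (((2 * Real.pi) ^ (2 * n) : ℝ) : ℂ) *
        Complex.exp (Complex.I * (⟪r + r', q⟫_ℝ : ℂ)) *
          Complex.exp (Complex.I * (ℏ : ℂ) / 2 * (⟪r, η r'⟫_ℝ : ℂ)) *
            H ((2 : ℝ)⁻¹ • η (r + r')) := by
  let L : EuclideanSpace ℝ (Fin n) ≃ₗ[ℝ] EuclideanSpace ℝ (Fin n) := LinearEquiv.ofBijective η hη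
  have hηc : ContDiff ℝ (⊤ : ℕ∞) η := (LinearMap.toContinuousLinearMap η).contDiff
  let Lh : EuclideanSpace ℝ (Fin n) ≃ₜ EuclideanSpace ℝ (Fin n) :=
    L.toContinuousLinearEquiv.toHomeomorph
  have hGd : ∀ ξ, ContDiff ℝ (⊤ : ℕ∞) (fun ζ => H (η (ζ + ξ))) := fun ξ =>
    hH.comp (hηc.comp (contDiff_id.add contDiff_const))
  have hGs : ∀ ξ, HasCompactSupport (fun ζ => H (η (ζ + ξ))) := fun ξ =>
    hHsupp.comp_homeomorph ((Homeomorph.addRight ξ).trans Lh)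
  have hk := fun ξ => key n _ (hGd ξ) (hGs ξ) r
    (Complex.exp (Complex.I * (⟪r, q + ℏ • η ξ⟫_ℝ : ℂ)))
  have hI : ∀ ξ, (∫ Y : EuclideanSpace ℝ (Fin n),
      Complex.exp (Complex.I * (⟪r, q + ℏ • η ξ⟫_ℝ : ℂ)) *
        Complex.exp (Complex.I / 2 * (⟪r, Y⟫_ℝ : ℂ)) *
          ∫ ζ : EuclideanSpace ℝ (Fin n),
            Complex.exp (-Complex.I * (⟪ζ, Y⟫_ℝ : ℂ)) * H (η (ζ + ξ))) = _ := fun ξ => (hk ξ).2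
  refine ⟨fun ξ Y => exp_integrable n _ (hGd ξ).continuous (hGs ξ) Y, fun ξ => (hk ξ).1, ?_⟩
  simp only [hI]
  have h2d : ContDiff ℝ (⊤ : ℕ∞) (fun ξ => Complex.exp (Complex.I * (⟪r, q + ℏ • η ξ⟫_ℝ : ℂ)) *
      (((2 * Real.pi) ^ n : ℝ) : ℂ) * H (η ((2 : ℝ)⁻¹ • r + ξ))) := by
    refine ContDiff.mul (ContDiff.mul ?_ contDiff_const) ?_
    · refine ContDiff.cexp (contDiff_const.mul (Complex.ofRealCLM.contDiff.comp ?_))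
      have h1 : ContDiff ℝ (⊤ : ℕ∞) (fun ξ => q + ℏ • η ξ) :=
        contDiff_const.add (hηc.const_smul ℏ)
      exact (innerSL ℝ r).contDiff.comp h1
    · exact hH.comp (hηc.comp (contDiff_const.add contDiff_id))
  have h2s : HasCompactSupport (fun ξ => Complex.exp (Complex.I * (⟪r, q + ℏ • η ξ⟫_ℝ : ℂ)) *
      (((2 * Real.pi) ^ n : ℝ) : ℂ) * H (η ((2 : ℝ)⁻¹ • r + ξ))) := by
    refine HasCompactSupport.mul_left ?_
    have h := hGs ((2 : ℝ)⁻¹ • r)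
    simp only [add_comm _ ((2 : ℝ)⁻¹ • r)] at h
    exact h
  have h3 := key n _ h2d h2s r' (Complex.exp (Complex.I * (⟪r', q⟫_ℝ : ℂ)))
  refine ⟨fun X => exp_integrable n _ h2d.continuous h2s X, h3.1, h3.2.trans ?_⟩
  rw [← smul_add, map_smul η _ (r + r'), map_smul η _ r', inner_add_left, inner_add_right,
    inner_smul_right, inner_smul_right]
  have e : Complex.exp (Complex.I * ((⟪r, q⟫_ℝ + ℏ * (2⁻¹ * ⟪r, η r'⟫_ℝ) : ℝ) : ℂ)) =
      Complex.exp (Complex.I * (⟪r, q⟫_ℝ : ℂ)) *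
        Complex.exp (Complex.I * (ℏ : ℂ) / 2 * (⟪r, η r'⟫_ℝ : ℂ)) := by
    rw [← Complex.exp_add]
    congr 1
    push_cast
    ring
  rw [e, Complex.ofReal_add, mul_add, Complex.exp_add]
  push_cast
  ring
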